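/- Let r > 0 and κ > 0 be real numbers and let l, m be natural numbers with l < m. Then (1/(2π))·∫_{ℝ} (r−it)^l·(r+it)^m / ( (r+it)^{l+1}·(r−it)^{m+1}·(κ+it) ) dt = (r−κ)^{m−l−1} / (r+κ)^{m−l+1}, and (1/(2π))·∫_{ℝ} (r−it)^l·(r+it)^m / ( (r+it)^{l+1}·(r−it)^{m+1}·(κ−it) ) dt = 0. -/

import Mathlib

open MeasureTheory Real Complex

namespace LagAux

lemma int_cauchy (q : ℝ) (hq : q ≠ 0) : Integrable (fun t : ℝ => (q ^ 2 + t ^ 2)⁻¹) := by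
  have h := (integrable_inv_one_add_sq.comp_mul_left' (inv_ne_zero hq)).const_mul ((q ^ 2)⁻¹)
  refine h.congr (Filter.Eventually.of_forall fun t => ?_)
  have : 0 < q ^ 2 + t ^ 2 := by positivity
  have h2 : 0 < 1 + (q⁻¹ * t) ^ 2 := by positivity
  simp only
  rw [← mul_inv]
  congr 1
  field_simp

lemma val_cauchy (q : ℝ) (hq : q ≠ 0) : ∫ t : ℝ, q / (q ^ 2 + t ^ 2) = |q| / q * π := by
  have h : ∀ t : ℝ, q / (q ^ 2 + t ^ 2) = q⁻¹ * (1 + (q⁻¹ * t) ^ 2)⁻¹ := by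
    intro t
    have : 0 < q ^ 2 + t ^ 2 := by positivity
    have h2 : 0 < 1 + (q⁻¹ * t) ^ 2 := by positivity
    rw [div_eq_mul_inv, ← mul_inv, eq_comm, inv_eq_iff_eq_inv, mul_inv, inv_inv]
    field_simp
  simp_rw [h]
  rw [integral_const_mul, Measure.integral_comp_mul_left (fun x : ℝ => (1 + x ^ 2)⁻¹),
    integral_univ_inv_one_add_sq]
  simp [inv_inv]
  ring

lemma ne_add (q t : ℝ) (hq : q ≠ 0) : (q : ℂ) + I * t ≠ 0 := by
  intro h
  have := congrArg Complex.re h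
  simp at this
  exact hq this

lemma ne_sub (q t : ℝ) (hq : q ≠ 0) : (q : ℂ) - I * t ≠ 0 := by
  intro h
  have := congrArg Complex.re h
  simp at this
  exact hq this

lemma normsq_add (q t : ℝ) : ‖(q : ℂ) + I * t‖ ^ 2 = q ^ 2 + t ^ 2 := by
  rw [← Complex.normSq_eq_norm_sq, Complex.normSq_apply]; simp; ring

lemma normsq_sub (q t : ℝ) : ‖(q : ℂ) - I * t‖ ^ 2 = q ^ 2 + t ^ 2 := by
  rw [← Complex.normSq_eq_norm_sq, Complex.normSq_apply]; simp; ring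

/-- basic integrability -/
lemma int_basic (p q : ℝ) (hp : p ≠ 0) (hq : q ≠ 0) :
    Integrable (fun t : ℝ => 1 / (((p : ℂ) - I * t) * ((q : ℂ) + I * t))) := by
  refine ((int_cauchy p hp).add (int_cauchy q hq)).mono' ?_ ?_
  · refine Continuous.aestronglyMeasurable ?_
    refine Continuous.div (by fun_prop) (by fun_prop) fun t => ?_
    exact mul_ne_zero (ne_sub p t hp) (ne_add q t hq)
  · refine Filter.Eventually.of_forall fun t => ?_
    simp only [Pi.add_apply]
    rw [← normsq_sub p t, ← normsq_add q t, norm_div, norm_mul, norm_one, one_div, mul_inv,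
      ← inv_pow, ← inv_pow]
    generalize ‖(p : ℂ) - I * t‖⁻¹ = x
    generalize ‖(q : ℂ) + I * t‖⁻¹ = y
    nlinarith [sq_nonneg (x - y), sq_nonneg (x + y)]

lemma norm_u (r t : ℝ) (hr : r ≠ 0) : ‖((r : ℂ) + I * t) / ((r : ℂ) - I * t)‖ = 1 := by
  have h1 := normsq_add r t
  have h2 := normsq_sub r t
  have h3 : ‖(r : ℂ) + I * t‖ = ‖(r : ℂ) - I * t‖ := by
    rw [← sq_eq_sq₀ (norm_nonneg _) (norm_nonneg _), h1, h2]
  rw [norm_div, h3, div_self]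
  exact norm_ne_zero_iff.2 (ne_sub r t hr)

lemma cont_u (r : ℝ) (hr : r ≠ 0) :
    Continuous (fun t : ℝ => ((r : ℂ) + I * t) / ((r : ℂ) - I * t)) :=
  Continuous.div (by fun_prop) (by fun_prop) fun t => ne_sub r t hr

lemma int_mul_u {f : ℝ → ℂ} (hf : Integrable f) (r : ℝ) (hr : r ≠ 0) (k : ℕ) :
    Integrable (fun t : ℝ => (((r : ℂ) + I * t) / ((r : ℂ) - I * t)) ^ k * f t) := by
  refine hf.bdd_mul (c := 1) ((cont_u r hr).pow k).aestronglyMeasurable ?_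
  refine Filter.Eventually.of_forall fun t => ?_
  rw [norm_pow, norm_u r t hr, one_pow]

lemma int_sq (r : ℝ) (hr : r ≠ 0) :
    Integrable (fun t : ℝ => 1 / ((r : ℂ) - I * t) ^ 2) := by
  have h := int_mul_u (int_basic r r hr hr) r hr 1
  refine h.congr (Filter.Eventually.of_forall fun t => ?_)
  have h1 := ne_sub r t hr
  have h2 := ne_add r t hr
  simp only
  field_simp

lemma int_three (r q : ℝ) (hr : r ≠ 0) (hq : q ≠ 0) :
    Integrable (fun t : ℝ => 1 / (((r : ℂ) - I * t) ^ 2 * ((q : ℂ) + I * t))) := by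
  refine (((int_basic r q hr hq).norm.const_mul |r|⁻¹)).mono' ?_ ?_
  · refine Continuous.aestronglyMeasurable ?_
    refine Continuous.div (by fun_prop) (by fun_prop) fun t => ?_
    exact mul_ne_zero (pow_ne_zero _ (ne_sub r t hr)) (ne_add q t hq)
  · refine Filter.Eventually.of_forall fun t => ?_
    have h : |r| ≤ ‖(r : ℂ) - I * t‖ := by
      have := Complex.abs_re_le_norm ((r : ℂ) - I * t)
      simpa using this
    have e : 1 / (((r : ℂ) - I * t) ^ 2 * ((q : ℂ) + I * t))
        = ((r : ℂ) - I * t)⁻¹ * (1 / (((r : ℂ) - I * t) * ((q : ℂ) + I * t))) := by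
      have h1 := ne_sub r t hr
      have h2 := ne_add q t hq
      field_simp
    rw [e, norm_mul, norm_inv]
    have : 0 < |r| := abs_pos.2 hr
    gcongr

lemma u_eq (r t : ℝ) (hr : r ≠ 0) : ((r : ℂ) + I * t) / ((r : ℂ) - I * t)
    = -1 + 2 * r * ((r : ℂ) - I * t)⁻¹ := by
  have h1 := ne_sub r t hr
  field_simp
  ring

lemma tend (r : ℝ) (hr : r ≠ 0) {L : Filter ℝ} (hL : Filter.Tendsto (fun t : ℝ => |t|) L Filter.atTop) :
    Filter.Tendsto (fun t : ℝ => ((r : ℂ) + I * t) / ((r : ℂ) - I * t)) L (nhds (-1)) := by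
  simp_rw [u_eq r _ hr]
  have : Filter.Tendsto (fun t : ℝ => ((r : ℂ) - I * t)⁻¹) L (nhds 0) := by
    refine Filter.Tendsto.comp (Filter.tendsto_inv₀_cobounded) ?_
    rw [← tendsto_norm_atTop_iff_cobounded]
    refine Filter.tendsto_atTop_mono (fun t => ?_) hL
    have := Complex.abs_im_le_norm ((r : ℂ) - I * t)
    simpa using this
  simpa using (this.const_mul (2 * (r : ℂ))).const_add (-1)

lemma zero_sq (r : ℝ) (hr : r ≠ 0) (k : ℕ) :
    ∫ t : ℝ, (((r : ℂ) + I * t) / ((r : ℂ) - I * t)) ^ k * (1 / ((r : ℂ) - I * t) ^ 2) = 0 := by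
  have hd : ∀ t : ℝ, HasDerivAt (fun t : ℝ => (((r : ℂ) + I * t) / ((r : ℂ) - I * t)) ^ (k + 1))
      (((k + 1) * 2 * r * I) *
       ((((r : ℂ) + I * t) / ((r : ℂ) - I * t)) ^ k * (1 / ((r : ℂ) - I * t) ^ 2))) t := by
    intro t
    have h0 : HasDerivAt (fun t : ℝ => I * (t : ℂ)) (I * 1) t :=
      (HasDerivAt.ofReal_comp (hasDerivAt_id t)).const_mul I
    have h := ((h0.const_add (r : ℂ)).div (h0.const_sub (r : ℂ)) (ne_sub r t hr)).pow (k + 1)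
    refine h.congr_deriv ?_
    have h1 := ne_sub r t hr
    simp only [Nat.add_sub_cancel, Pi.div_apply]
    push_cast
    field_simp
    ring
  have hi := (int_mul_u (int_sq r hr) r hr k).const_mul ((k + 1) * 2 * r * I : ℂ)
  have := integral_of_hasDerivAt_of_tendsto hd hi
    ((tend r hr Filter.tendsto_abs_atBot_atTop).pow (k + 1))
    ((tend r hr Filter.tendsto_abs_atTop_atTop).pow (k + 1))
  rw [integral_const_mul, sub_self] at this
  refine (mul_eq_zero.1 this).resolve_left ?_
  have : (k + 1 : ℂ) ≠ 0 := by exact_mod_cast k.succ_ne_zero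
  simp [this, hr, I_ne_zero]

lemma cube_eq (r t : ℝ) (hr : r ≠ 0) (k : ℕ) :
    (((r : ℂ) + I * t) / ((r : ℂ) - I * t)) ^ k * (1 / ((r : ℂ) - I * t) ^ 3) =
    (1 / (2 * r)) * ((((r : ℂ) + I * t) / ((r : ℂ) - I * t)) ^ k * (1 / ((r : ℂ) - I * t) ^ 2)) +
    (1 / (2 * r)) * ((((r : ℂ) + I * t) / ((r : ℂ) - I * t)) ^ (k+1) * (1 / ((r : ℂ) - I * t) ^ 2)) := by
  have h1 := ne_sub r t hr
  have h2 : (r : ℂ) ≠ 0 := by exact_mod_cast hr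
  rw [pow_succ _ k]
  generalize (((r : ℂ) + I * t) / ((r : ℂ) - I * t)) ^ k = w
  field_simp
  ring

lemma int_cube (r : ℝ) (hr : r ≠ 0) (k : ℕ) : Integrable (fun t : ℝ =>
    (((r : ℂ) + I * t) / ((r : ℂ) - I * t)) ^ k * (1 / ((r : ℂ) - I * t) ^ 3)) := by
  simp_rw [cube_eq r _ hr k]
  exact ((int_mul_u (int_sq r hr) r hr k).const_mul _).add
    ((int_mul_u (int_sq r hr) r hr (k + 1)).const_mul _)

lemma zero_cube (r : ℝ) (hr : r ≠ 0) (k : ℕ) :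
    ∫ t : ℝ, (((r : ℂ) + I * t) / ((r : ℂ) - I * t)) ^ k * (1 / ((r : ℂ) - I * t) ^ 3) = 0 := by
  simp_rw [cube_eq r _ hr k]
  rw [integral_add ((int_mul_u (int_sq r hr) r hr k).const_mul _)
    ((int_mul_u (int_sq r hr) r hr (k + 1)).const_mul _), integral_const_mul, integral_const_mul,
    zero_sq r hr, zero_sq r hr]
  simp

lemma val_basic (r q : ℝ) (hr : 0 < r) (hq : q ≠ 0) (hs : r + q ≠ 0) :
    ∫ t : ℝ, 1 / (((r : ℂ) - I * t) * ((q : ℂ) + I * t)) =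
      (((1 + |q| / q) * π / (r + q) : ℝ) : ℂ) := by
  set f : ℝ → ℂ := fun t => 1 / (((r : ℂ) - I * t) * ((q : ℂ) + I * t)) with hf
  have hi : Integrable f := int_basic r q hr.ne' hq
  have h1 : ∫ t, f (-t) = ∫ t, f t := integral_neg_eq_self f volume
  have h2 : ∫ t, (f t + f (-t)) = (∫ t, f t) + ∫ t, f (-t) := integral_add hi hi.comp_neg
  have h3 : ∀ t : ℝ, f t + f (-t) =
      (((2 / (r + q)) * (r / (r ^ 2 + t ^ 2) + q / (q ^ 2 + t ^ 2)) : ℝ) : ℂ) := by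
    intro t
    have a1 := ne_sub r t hr.ne'
    have a2 := ne_add r t hr.ne'
    have a3 := ne_sub q t hq
    have a4 := ne_add q t hq
    have a5 : (r : ℂ) + q ≠ 0 := by exact_mod_cast hs
    have e1 : (r : ℂ) ^ 2 + t ^ 2 = (r - I * t) * (r + I * t) := by
      ring_nf; simp
    have e2 : (q : ℂ) ^ 2 + t ^ 2 = (q - I * t) * (q + I * t) := by
      ring_nf; simp
    simp only [hf]
    push_cast
    rw [e1, e2]
    simp only [mul_neg, sub_neg_eq_add, ← sub_eq_add_neg]
    field_simp
    ring
  simp_rw [h3] at h2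
  rw [integral_complex_ofReal, integral_const_mul, integral_add, val_cauchy r hr.ne', val_cauchy q hq, h1] at h2
  · have h4 : ∫ t, f t = (1 / 2) * ((∫ t, f t) + ∫ t, f t) := by ring
    rw [h4, ← h2, abs_of_pos hr, div_self hr.ne']
    push_cast
    ring
  · exact (int_cauchy r hr.ne').const_mul r
  · exact (int_cauchy q hq).const_mul q

lemma val_S (r q : ℝ) (hr : 0 < r) (hq : q ≠ 0) (hs : r + q ≠ 0) (k : ℕ) :
    ∫ t : ℝ, (((r : ℂ) + I * t) / ((r : ℂ) - I * t)) ^ k *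
        (1 / (((r : ℂ) - I * t) ^ 2 * ((q : ℂ) + I * t))) =
      (((1 + |q| / q) * π * (r - q) ^ k / (r + q) ^ (k + 2) : ℝ) : ℂ) := by
  have a5 : (r : ℂ) + q ≠ 0 := by exact_mod_cast hs
  induction k with
  | zero =>
    have h : ∀ t : ℝ, (((r : ℂ) + I * t) / ((r : ℂ) - I * t)) ^ 0 *
        (1 / (((r : ℂ) - I * t) ^ 2 * ((q : ℂ) + I * t))) =
        (1 / (r + q)) * ((((r : ℂ) + I * t) / ((r : ℂ) - I * t)) ^ 0 * (1 / ((r : ℂ) - I * t) ^ 2))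
        + (1 / (r + q)) * (1 / (((r : ℂ) - I * t) * ((q : ℂ) + I * t))) := by
      intro t
      have a1 := ne_sub r t hr.ne'
      have a4 := ne_add q t hq
      simp only [pow_zero]
      field_simp
      ring
    simp_rw [h]
    rw [integral_add ((int_mul_u (int_sq r hr.ne') r hr.ne' 0).const_mul _)
      ((int_basic r q hr.ne' hq).const_mul _), integral_const_mul, integral_const_mul,
      zero_sq r hr.ne', val_basic r q hr hq hs]
    push_cast
    field_simp
    ring
  | succ k ih =>
    have h : ∀ t : ℝ, (((r : ℂ) + I * t) / ((r : ℂ) - I * t)) ^ (k + 1) *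
        (1 / (((r : ℂ) - I * t) ^ 2 * ((q : ℂ) + I * t))) =
        ((r - q) / (r + q)) * ((((r : ℂ) + I * t) / ((r : ℂ) - I * t)) ^ k *
          (1 / (((r : ℂ) - I * t) ^ 2 * ((q : ℂ) + I * t))))
        + (2 * r / (r + q)) * ((((r : ℂ) + I * t) / ((r : ℂ) - I * t)) ^ k *
          (1 / ((r : ℂ) - I * t) ^ 3)) := by
      intro t
      have a1 := ne_sub r t hr.ne'
      have a4 := ne_add q t hq
      rw [pow_succ _ k]
      generalize (((r : ℂ) + I * t) / ((r : ℂ) - I * t)) ^ k = w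
      field_simp
      ring
    simp_rw [h]
    rw [integral_add ((int_mul_u (int_three r q hr.ne' hq) r hr.ne' k).const_mul _)
      ((int_cube r hr.ne' k).const_mul _), integral_const_mul, integral_const_mul,
      zero_cube r hr.ne', ih]
    push_cast
    field_simp
    ring

end LagAux

/-- Lemma A.1, case `l < m`: with `s^±_{l,m}` the displayed Laguerre integrals,
`s^+_{l,m} = (r−κ)^{m−l−1}/(r+κ)^{m−l+1}` and `s^-_{l,m} = 0`. -/
theorem laguerre_integral_l_lt_m (r κ : ℝ) (hr : 0 < r) (hκ : 0 < κ)
    (l m : ℕ) (hlm : l < m) :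
    (1 / (2 * Real.pi) : ℂ) *
        ∫ t : ℝ, ((r : ℂ) - Complex.I * t) ^ l * ((r : ℂ) + Complex.I * t) ^ m /
          (((r : ℂ) + Complex.I * t) ^ (l + 1) * ((r : ℂ) - Complex.I * t) ^ (m + 1) *
            ((κ : ℂ) + Complex.I * t)) =
      (((r - κ) ^ (m - l - 1) / (r + κ) ^ (m - l + 1) : ℝ) : ℂ) ∧
    (1 / (2 * Real.pi) : ℂ) *
        ∫ t : ℝ, ((r : ℂ) - Complex.I * t) ^ l * ((r : ℂ) + Complex.I * t) ^ m /
          (((r : ℂ) + Complex.I * t) ^ (l + 1) * ((r : ℂ) - Complex.I * t) ^ (m + 1) *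
            ((κ : ℂ) - Complex.I * t)) = 0 := by
  obtain ⟨k, rfl⟩ : ∃ k, m = l + k + 1 := ⟨m - l - 1, by omega⟩
  have e1 : l + k + 1 - l - 1 = k := by omega
  have e2 : l + k + 1 - l + 1 = k + 2 := by omega
  rw [e1, e2]
  have key : ∀ (t : ℝ) (z : ℂ), ((r : ℂ) - Complex.I * t) ^ l * ((r : ℂ) + Complex.I * t) ^ (l + k + 1) /
          (((r : ℂ) + Complex.I * t) ^ (l + 1) * ((r : ℂ) - Complex.I * t) ^ (l + k + 1 + 1) * z)
        = (((r : ℂ) + I * t) / ((r : ℂ) - I * t)) ^ k * (1 / (((r : ℂ) - I * t) ^ 2 * z)) := by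
    intro t z
    have a1 := LagAux.ne_sub r t hr.ne'
    have a2 := LagAux.ne_add r t hr.ne'
    rw [div_pow, div_mul_div_comm, mul_one, ← mul_assoc, ← div_div, ← div_div (_ ^ k)]
    congr 1
    rw [div_eq_div_iff (by positivity) (by positivity)]
    ring
  simp_rw [key]
  constructor
  · rw [LagAux.val_S r κ hr hκ.ne' (by positivity), abs_of_pos hκ, div_self hκ.ne']
    have : (π : ℂ) ≠ 0 := by exact_mod_cast Real.pi_ne_zero
    push_cast
    field_simp
    ring
  · by_cases h : r = κ
    · subst h
      have := LagAux.zero_cube r hr.ne' k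
      simp_rw [← pow_succ]
      norm_num only
      rw [this, mul_zero]
    · have hS := LagAux.val_S r (-κ) hr (neg_ne_zero.2 hκ.ne')
        (by rw [← sub_eq_add_neg]; exact sub_ne_zero.2 h) k
      have hz : ∀ t : ℝ, (((r : ℂ) + I * t) / ((r : ℂ) - I * t)) ^ k *
          (1 / (((r : ℂ) - I * t) ^ 2 * ((κ : ℂ) - I * t))) =
          -((((r : ℂ) + I * t) / ((r : ℂ) - I * t)) ^ k *
          (1 / (((r : ℂ) - I * t) ^ 2 * (((-κ : ℝ) : ℂ) + I * t)))) := by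
        intro t
        have : (((-κ : ℝ) : ℂ) + I * t) = -((κ : ℂ) - I * t) := by push_cast; ring
        rw [this, mul_neg, div_neg, mul_neg, neg_neg]
      simp_rw [hz]
      rw [integral_neg, hS, abs_neg, abs_of_pos hκ, div_neg, div_self hκ.ne']
      simp
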